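/- The space 𝒜 = Ã₁ ∩ Ã₂ equipped with the norm ‖A‖_𝒜 = max{‖A‖_Ã₁, ‖A‖_Ã₂} is complete, i.e., every Cauchy sequence in (𝒜, ‖·‖_𝒜) converges in 𝒜. -/

import Mathlib

open scoped ComplexConjugate

noncomputable section

namespace PaperTensor

variable {I I₁ I₂ : Type*}

/-- The space `ℓ²(I)`. -/
abbrev L2 (I : Type*) := lp (fun _ : I => ℂ) 2

/-- The continuous linear map `T` represents the matrix `M` as an operator on `ℓ²(I)`,
i.e. `(T c) k = Σ_l M k l * c l` for every `c ∈ ℓ²(I)`. -/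
def Represents (M : I → I → ℂ) (T : L2 I →L[ℂ] L2 I) : Prop :=
  ∀ c : L2 I, ∀ k : I, HasSum (fun l : I => M k l * (c : ∀ _ : I, ℂ) l) ((T c : ∀ _ : I, ℂ) k)

/-- `M` defines a bounded operator on `ℓ²(I)`. -/
def Bounded2 (M : I → I → ℂ) : Prop := ∃ T : L2 I →L[ℂ] L2 I, Represents M T

/-- The operator norm `‖M‖_{B(ℓ²(I))}` of the matrix `M` (junk value `0` if `M` is unbounded). -/
noncomputable def opNorm2 (M : I → I → ℂ) : ℝ :=
  letI : Decidable (Bounded2 M) := Classical.propDecidable _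
  if h : Bounded2 M then ‖h.choose‖ else 0

/-- The matrix product of two infinite matrices. -/
noncomputable def matMul (A B : I → I → ℂ) : I → I → ℂ :=
  fun i j => ∑' m : I, A i m * B m j

/-- The conjugate transpose of a matrix. -/
def conjTranspose (A : I → I → ℂ) : I → I → ℂ := fun i j => conj (A j i)

/-- A solid Banach algebra of (infinite) matrices over the index set `I`. -/
structure SolidBanachAlgebra (I : Type*) where
  carrier : Set (I → I → ℂ)
  anorm : (I → I → ℂ) → ℝ
  zero_mem : (0 : I → I → ℂ) ∈ carrier
  add_mem : ∀ A B : I → I → ℂ, A ∈ carrier → B ∈ carrier → A + B ∈ carrier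
  smul_mem : ∀ (c : ℂ) (A : I → I → ℂ), A ∈ carrier → c • A ∈ carrier
  mul_mem : ∀ A B : I → I → ℂ, A ∈ carrier → B ∈ carrier → matMul A B ∈ carrier
  anorm_nonneg : ∀ A ∈ carrier, 0 ≤ anorm A
  anorm_zero : anorm 0 = 0
  anorm_eq_zero : ∀ A ∈ carrier, anorm A = 0 → A = 0
  anorm_smul : ∀ (c : ℂ), ∀ A ∈ carrier, anorm (c • A) = ‖c‖ * anorm A
  anorm_add : ∀ A ∈ carrier, ∀ B ∈ carrier, anorm (A + B) ≤ anorm A + anorm B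
  anorm_mul : ∀ A ∈ carrier, ∀ B ∈ carrier, anorm (matMul A B) ≤ anorm A * anorm B
  complete : ∀ f : ℕ → (I → I → ℂ), (∀ n, f n ∈ carrier) →
      (∀ ε > (0 : ℝ), ∃ N : ℕ, ∀ m ≥ N, ∀ n ≥ N, anorm (f m - f n) < ε) →
      ∃ A ∈ carrier, ∀ ε > (0 : ℝ), ∃ N : ℕ, ∀ n ≥ N, anorm (f n - A) < ε
  bounded : ∀ A ∈ carrier, Bounded2 A
  solid : ∀ A ∈ carrier, ∀ B : I → I → ℂ,
      (∀ i j, ‖B i j‖ ≤ ‖A i j‖) → B ∈ carrier ∧ anorm B ≤ anorm A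

/-- A matrix algebra is involutive if it is closed under conjugate transposition and the
norm is invariant under it. -/
def SolidBanachAlgebra.Involutive (𝒜 : SolidBanachAlgebra I) : Prop :=
  ∀ A ∈ 𝒜.carrier, conjTranspose A ∈ 𝒜.carrier ∧ 𝒜.anorm (conjTranspose A) = 𝒜.anorm A

/-- Rank-four tensors `(A_{i,k,l,j})` indexed by `I₁ × I₂² × I₁`. -/
abbrev Tensor (I₁ I₂ : Type*) := I₁ → I₂ → I₂ → I₁ → ℂ

/-- The restriction `A|_{{i} × I₂² × {j}}`, an `I₂ × I₂` matrix. -/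
def res1 (A : Tensor I₁ I₂) (i j : I₁) : I₂ → I₂ → ℂ := fun k l => A i k l j

/-- The restriction `A|_{I₁ × {(k,l)} × I₁}`, an `I₁ × I₁` matrix. -/
def res2 (A : Tensor I₁ I₂) (k l : I₂) : I₁ → I₁ → ℂ := fun i j => A i k l j

/-- Membership in `Ã₁`, for a set `S` of `I₁ × I₁` matrices playing the role of `𝒜₁`:
all restrictions `A|_{{i} × I₂² × {j}}` are bounded on `ℓ²(I₂)` and the matrix of their
operator norms belongs to `S`. -/
def MemT1 (S : Set (I₁ → I₁ → ℂ)) (A : Tensor I₁ I₂) : Prop :=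
  (∀ i j : I₁, Bounded2 (res1 A i j)) ∧
    (fun i j : I₁ => (opNorm2 (res1 A i j) : ℂ)) ∈ S

/-- Membership in `Ã₂`. -/
def MemT2 (S : Set (I₂ → I₂ → ℂ)) (A : Tensor I₁ I₂) : Prop :=
  (∀ k l : I₂, Bounded2 (res2 A k l)) ∧
    (fun k l : I₂ => (opNorm2 (res2 A k l) : ℂ)) ∈ S

/-- The norm `‖A‖_{Ã₁}` (meaningful on members of `Ã₁`). -/
noncomputable def normT1 (𝒜₁ : SolidBanachAlgebra I₁) (A : Tensor I₁ I₂) : ℝ :=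
  𝒜₁.anorm (fun i j : I₁ => (opNorm2 (res1 A i j) : ℂ))

/-- The norm `‖A‖_{Ã₂}` (meaningful on members of `Ã₂`). -/
noncomputable def normT2 (𝒜₂ : SolidBanachAlgebra I₂) (A : Tensor I₁ I₂) : ℝ :=
  𝒜₂.anorm (fun k l : I₂ => (opNorm2 (res2 A k l) : ℂ))

/-- Membership in `𝒜 = Ã₁ ∩ Ã₂`. -/
def MemA (𝒜₁ : SolidBanachAlgebra I₁) (𝒜₂ : SolidBanachAlgebra I₂) (A : Tensor I₁ I₂) : Prop :=
  MemT1 𝒜₁.carrier A ∧ MemT2 𝒜₂.carrier A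

/-- The norm `‖A‖_𝒜 = max {‖A‖_{Ã₁}, ‖A‖_{Ã₂}}`. -/
noncomputable def normA (𝒜₁ : SolidBanachAlgebra I₁) (𝒜₂ : SolidBanachAlgebra I₂)
    (A : Tensor I₁ I₂) : ℝ :=
  max (normT1 𝒜₁ A) (normT2 𝒜₂ A)

/-- The matrix over `I₁ × I₂` through which a rank-four tensor acts on `ℓ²(I₁ × I₂)`:
`(Ac)_{(i,k)} = Σ_{(m,n)} A_{i,k,n,m} c_{(m,n)}`. -/
def toMatrix (A : Tensor I₁ I₂) : (I₁ × I₂) → (I₁ × I₂) → ℂ :=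
  fun p q => A p.1 p.2 q.2 q.1

/-- The rank-four tensor of matrix entries of an operator `T` on `ℓ²(I₁ × I₂)`:
its `(i,k,l,j)` entry is the `((i,k),(j,l))` matrix entry of `T`. -/
noncomputable def entryTensor (T : L2 (I₁ × I₂) →L[ℂ] L2 (I₁ × I₂)) : Tensor I₁ I₂ :=
  letI : DecidableEq (I₁ × I₂) := Classical.decEq _
  fun i k l j => (T (lp.single 2 (j, l) (1 : ℂ)) : ∀ _ : I₁ × I₂, ℂ) (i, k)

/-- A set `S` of rank-four tensors is inverse-closed if, whenever `A ∈ S` acts as a boundedly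
invertible operator on `ℓ²(I₁ × I₂)`, the rank-four tensor of matrix entries of the inverse
operator also belongs to `S`. -/
def InverseClosed (S : Set (Tensor I₁ I₂)) : Prop :=
  ∀ A ∈ S, ∀ T Tinv : L2 (I₁ × I₂) →L[ℂ] L2 (I₁ × I₂),
    Represents (toMatrix A) T →
    T.comp Tinv = ContinuousLinearMap.id ℂ (L2 (I₁ × I₂)) →
    Tinv.comp T = ContinuousLinearMap.id ℂ (L2 (I₁ × I₂)) →
    entryTensor Tinv ∈ S

/-- The doubly contracted tensor product
`(A : B)_{i,k,l,j} = Σ_{n ∈ I₂} Σ_{m ∈ I₁} A_{i,k,n,m} B_{m,n,l,j}`. -/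
noncomputable def contract (A B : Tensor I₁ I₂) : Tensor I₁ I₂ :=
  fun i k l j => ∑' n : I₂, ∑' m : I₁, A i k n m * B m n l j

/-- Absolute convergence of all series defining the doubly contracted tensor product. -/
def ContractSummable (A B : Tensor I₁ I₂) : Prop :=
  ∀ (i : I₁) (k l : I₂) (j : I₁),
    Summable (fun nm : I₂ × I₁ => ‖A i k nm.1 nm.2 * B nm.2 nm.1 l j‖)

/-- The adjoint tensor `(A*)_{i,k,l,j} = conj (A_{j,l,k,i})`. -/
def adjT (A : Tensor I₁ I₂) : Tensor I₁ I₂ := fun i k l j => conj (A j l k i)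

open Filter Topology

/-- Evaluation at an index, as a continuous linear functional on `ℓ²(I)`. -/
def evalL2 (k : I) : L2 I →L[ℂ] ℂ :=
  LinearMap.mkContinuous
    { toFun := fun c => c k
      map_add' := fun _ _ => rfl
      map_smul' := fun _ _ => rfl } 1 fun c => by
    rw [one_mul]
    exact lp.norm_apply_le_norm two_ne_zero c k

/-- The matrix of an operator on `ℓ²(I)` with respect to the standard basis. -/
def entries (T : L2 I →L[ℂ] L2 I) : I → I → ℂ :=
  letI : DecidableEq I := Classical.decEq _
  fun k l => (T (lp.single 2 l (1 : ℂ)) : ∀ _ : I, ℂ) k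

theorem represents_entries (T : L2 I →L[ℂ] L2 I) : Represents (entries T) T := by
  classical
  intro c k
  have h := ((lp.hasSum_single (by norm_num : (2 : ENNReal) ≠ ⊤) c).mapL T).mapL
    (evalL2 k)
  change HasSum _ (evalL2 k (T c))
  convert h using 1
  funext l
  have hs : lp.single 2 l (c l) = c l • (lp.single 2 l (1 : ℂ) : L2 I) := by
    rw [← lp.single_smul, smul_eq_mul, mul_one]
  rw [hs, map_smul, map_smul, smul_eq_mul, mul_comm]
  simp only [entries, evalL2]
  congr!

theorem Represents.eq_entries {M : I → I → ℂ} {T : L2 I →L[ℂ] L2 I} (h : Represents M T) :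
    M = entries T := by
  funext k l
  have h1 := h (letI := Classical.decEq I; lp.single 2 l (1 : ℂ)) k
  have h2 := h1.unique (hasSum_single l fun m hm => by simp [hm])
  simpa [entries] using h2.symm

theorem Represents.ext {M : I → I → ℂ} {T S : L2 I →L[ℂ] L2 I} (hT : Represents M T)
    (hS : Represents M S) : T = S := by
  ext c k
  exact (hT c k).unique (hS c k)

theorem Represents.opNorm2_eq {M : I → I → ℂ} {T : L2 I →L[ℂ] L2 I} (h : Represents M T) :
    opNorm2 M = ‖T‖ := by
  have hb : Bounded2 M := ⟨T, h⟩
  rw [opNorm2, dif_pos hb, hb.choose_spec.ext h]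

theorem Represents.sub {M N : I → I → ℂ} {T S : L2 I →L[ℂ] L2 I} (hT : Represents M T)
    (hS : Represents N S) : Represents (M - N) (T - S) := by
  intro c k
  simpa [sub_mul] using (hT c k).sub (hS c k)

theorem tendsto_entries {T : ℕ → L2 I →L[ℂ] L2 I} {S : L2 I →L[ℂ] L2 I}
    (h : Tendsto T atTop (𝓝 S)) (k l : I) :
    Tendsto (fun n => entries (T n) k l) atTop (𝓝 (entries S k l)) := by
  classical
  have hc : Continuous fun T : L2 I →L[ℂ] L2 I => entries T k l :=
    (evalL2 k).continuous.comp
      (ContinuousLinearMap.apply ℂ (L2 I) _).continuous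
  exact (hc.tendsto S).comp h

namespace SolidBanachAlgebra

variable (𝒜 : SolidBanachAlgebra I)

theorem sub_mem {A B : I → I → ℂ} (hA : A ∈ 𝒜.carrier) (hB : B ∈ 𝒜.carrier) :
    A - B ∈ 𝒜.carrier := by
  simpa [sub_eq_add_neg] using 𝒜.add_mem _ _ hA (𝒜.smul_mem (-1) _ hB)

theorem exists_norm_apply_le (i j : I) :
    ∃ C : ℝ, 0 < C ∧ ∀ B ∈ 𝒜.carrier, ‖B i j‖ ≤ C * 𝒜.anorm B := by
  classical
  set E : I → I → ℂ := fun a b => if a = i ∧ b = j then 1 else 0 with hE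
  have hsolid : ∀ B ∈ 𝒜.carrier, B i j • E ∈ 𝒜.carrier ∧ 𝒜.anorm (B i j • E) ≤ 𝒜.anorm B := by
    refine fun B hB => 𝒜.solid B hB _ fun a b => ?_
    by_cases h : a = i ∧ b = j
    · simp [hE, h]
    · simp [hE, h]
  by_cases hmem : E ∈ 𝒜.carrier
  · have hpos : 0 < 𝒜.anorm E := by
      refine (𝒜.anorm_nonneg E hmem).lt_of_ne' fun h => ?_
      simpa [hE] using congrFun (congrFun (𝒜.anorm_eq_zero E hmem h) i) j
    refine ⟨(𝒜.anorm E)⁻¹, inv_pos.2 hpos, fun B hB => ?_⟩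
    have h := (hsolid B hB).2
    rw [𝒜.anorm_smul _ _ hmem] at h
    rw [inv_mul_eq_div, le_div_iff₀ hpos]
    exact h
  · refine ⟨1, one_pos, fun B hB => ?_⟩
    have h0 : B i j = 0 := by
      by_contra h
      have := 𝒜.smul_mem (B i j)⁻¹ _ (hsolid B hB).1
      rw [inv_smul_smul₀ h] at this
      exact hmem this
    simpa [h0] using 𝒜.anorm_nonneg B hB

theorem tendsto_apply {B : ℕ → I → I → ℂ} {A : I → I → ℂ} (hB : ∀ n, B n ∈ 𝒜.carrier)
    (hA : A ∈ 𝒜.carrier) (h : ∀ ε > (0 : ℝ), ∃ N : ℕ, ∀ n ≥ N, 𝒜.anorm (B n - A) < ε)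
    (i j : I) : Tendsto (fun n => B n i j) atTop (𝓝 (A i j)) := by
  obtain ⟨C, hC, hle⟩ := 𝒜.exists_norm_apply_le i j
  rw [Metric.tendsto_atTop]
  intro ε hε
  obtain ⟨N, hN⟩ := h (ε / C) (div_pos hε hC)
  refine ⟨N, fun n hn => ?_⟩
  rw [dist_eq_norm]
  calc ‖B n i j - A i j‖ ≤ C * 𝒜.anorm (B n - A) := hle _ (𝒜.sub_mem (hB n) hA)
    _ < C * (ε / C) := mul_lt_mul_of_pos_left (hN n hn) hC
    _ = ε := mul_div_cancel₀ ε hC.ne'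

variable {E : Type*} [NormedAddCommGroup E]

/-- The matrix of norms of a matrix with entries in a normed group. -/
abbrev normMatrix (T : I → I → E) : I → I → ℂ := fun i j => (‖T i j‖ : ℂ)

theorem normMatrix_sub (T S : I → I → E) :
    normMatrix (T - S) = fun i j => (‖T i j - S i j‖ : ℂ) := rfl

theorem norm_normMatrix_sub_le (T S : I → I → E) (i j : I) :
    ‖(normMatrix T - normMatrix S) i j‖ ≤ ‖normMatrix (T - S) i j‖ := by
  simp only [normMatrix, Pi.sub_apply, ← Complex.ofReal_sub, Complex.norm_real, norm_norm]
  exact abs_norm_sub_norm_le _ _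

theorem normMatrix_sub_mem {T S : I → I → E} (hT : normMatrix T ∈ 𝒜.carrier)
    (hS : normMatrix S ∈ 𝒜.carrier) : normMatrix (T - S) ∈ 𝒜.carrier := by
  refine (𝒜.solid _ (𝒜.add_mem _ _ hT hS) _ fun i j => ?_).1
  simp only [normMatrix, Pi.sub_apply, Pi.add_apply, ← Complex.ofReal_add, Complex.norm_real,
    norm_norm]
  exact (norm_sub_le _ _).trans (le_abs_self _)

/-- The norm on matrices with entries in a normed group is lower semicontinuous along Cauchy
sequences that converge entrywise. -/
theorem normMatrix_limit {T : ℕ → I → I → E} {S : I → I → E}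
    (hT : ∀ n, normMatrix (T n) ∈ 𝒜.carrier)
    (hcauchy : ∀ ε > (0 : ℝ), ∃ N : ℕ, ∀ m ≥ N, ∀ n ≥ N,
      𝒜.anorm (normMatrix (T m - T n)) < ε)
    (hlim : ∀ i j, Tendsto (fun n => T n i j) atTop (𝓝 (S i j))) :
    normMatrix S ∈ 𝒜.carrier ∧ ∀ r : ℝ, (∃ N : ℕ, ∀ n ≥ N, 𝒜.anorm (normMatrix (T n)) ≤ r) →
      𝒜.anorm (normMatrix S) ≤ r := by
  have hle : ∀ m n, 𝒜.anorm (normMatrix (T m) - normMatrix (T n)) ≤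
      𝒜.anorm (normMatrix (T m - T n)) := fun m n =>
    (𝒜.solid _ (𝒜.normMatrix_sub_mem (hT m) (hT n)) _ (norm_normMatrix_sub_le _ _)).2
  obtain ⟨A, hA, hconv⟩ := 𝒜.complete (fun n => normMatrix (T n)) hT fun ε hε =>
    (hcauchy ε hε).imp fun N hN m hm n hn => (hle m n).trans_lt (hN m hm n hn)
  have hAS : A = normMatrix S := by
    funext i j
    refine tendsto_nhds_unique (𝒜.tendsto_apply hT hA hconv i j) ?_
    exact (Complex.continuous_ofReal.tendsto _).comp (hlim i j).norm
  subst hAS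
  refine ⟨hA, fun r ⟨N, hN⟩ => le_of_forall_pos_lt_add fun ε hε => ?_⟩
  obtain ⟨N', hN'⟩ := hconv ε hε
  set n := max N N'
  have hn := hN n (le_max_left _ _)
  have hn' := hN' n (le_max_right _ _)
  have hd := 𝒜.sub_mem (hT n) hA
  have hneg : 𝒜.anorm ((-1 : ℂ) • (normMatrix (T n) - normMatrix S)) =
      𝒜.anorm (normMatrix (T n) - normMatrix S) := by
    rw [𝒜.anorm_smul _ _ hd]; simp
  have hadd := 𝒜.anorm_add _ (hT n) _ (𝒜.smul_mem (-1) _ hd)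
  have heq : normMatrix (T n) + (-1 : ℂ) • (normMatrix (T n) - normMatrix S) =
      normMatrix S := by
    module
  rw [heq, hneg] at hadd
  linarith

theorem exists_normMatrix_limit [CompleteSpace E] {T : ℕ → I → I → E}
    (hT : ∀ n, normMatrix (T n) ∈ 𝒜.carrier)
    (hcauchy : ∀ ε > (0 : ℝ), ∃ N : ℕ, ∀ m ≥ N, ∀ n ≥ N,
      𝒜.anorm (normMatrix (T m - T n)) < ε) :
    ∃ S : I → I → E, (∀ i j, Tendsto (fun n => T n i j) atTop (𝓝 (S i j))) ∧
      normMatrix S ∈ 𝒜.carrier ∧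
      ∀ ε > (0 : ℝ), ∃ N : ℕ, ∀ n ≥ N, 𝒜.anorm (normMatrix (T n - S)) < ε := by
  have hlim : ∀ i j, ∃ s, Tendsto (fun n => T n i j) atTop (𝓝 s) := by
    intro i j
    refine cauchySeq_tendsto_of_complete (Metric.cauchySeq_iff.2 fun ε hε => ?_)
    obtain ⟨C, hC, hle⟩ := 𝒜.exists_norm_apply_le i j
    obtain ⟨N, hN⟩ := hcauchy (ε / C) (div_pos hε hC)
    refine ⟨N, fun m hm n hn => ?_⟩
    have h := hle _ (𝒜.normMatrix_sub_mem (hT m) (hT n))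
    simp only [normMatrix, Complex.norm_real, norm_norm] at h
    rw [dist_eq_norm]
    calc ‖T m i j - T n i j‖ ≤ C * 𝒜.anorm (normMatrix (T m - T n)) := h
      _ < C * (ε / C) := mul_lt_mul_of_pos_left (hN m hm n hn) hC
      _ = ε := mul_div_cancel₀ ε hC.ne'
  choose S hS using hlim
  refine ⟨S, hS, (𝒜.normMatrix_limit hT hcauchy hS).1, fun ε hε => ?_⟩
  obtain ⟨N, hN⟩ := hcauchy (ε / 2) (half_pos hε)
  refine ⟨N, fun n hn => lt_of_le_of_lt ?_ (half_lt_self hε)⟩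
  refine (𝒜.normMatrix_limit (T := fun m => T n - T m)
    (fun m => 𝒜.normMatrix_sub_mem (hT n) (hT m)) (fun δ hδ => ?_)
    fun i j => (hS i j).const_sub _).2 _ ⟨N, fun m hm => (hN n hn m hm).le⟩
  obtain ⟨N', hN'⟩ := hcauchy δ hδ
  refine ⟨N', fun m hm k hk => ?_⟩
  rw [sub_sub_sub_cancel_left]
  exact hN' k hk m hm

/-- Completeness of the space of families `M i j` of matrices over `J`, bounded on `ℓ²(J)`, whose
matrix of operator norms belongs to `𝒜`. -/
theorem exists_opNorm2_limit {J : Type*} (M : ℕ → I → I → J → J → ℂ)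
    (hb : ∀ n i j, Bounded2 (M n i j))
    (hM : ∀ n, (fun i j => (opNorm2 (M n i j) : ℂ)) ∈ 𝒜.carrier)
    (hcauchy : ∀ ε > (0 : ℝ), ∃ N : ℕ, ∀ m ≥ N, ∀ n ≥ N,
      𝒜.anorm (fun i j => (opNorm2 (M m i j - M n i j) : ℂ)) < ε) :
    ∃ L : I → I → J → J → ℂ,
      (∀ i j k l, Tendsto (fun n => M n i j k l) atTop (𝓝 (L i j k l))) ∧
      (∀ i j, Bounded2 (L i j)) ∧ (fun i j => (opNorm2 (L i j) : ℂ)) ∈ 𝒜.carrier ∧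
      ∀ ε > (0 : ℝ), ∃ N : ℕ, ∀ n ≥ N,
        𝒜.anorm (fun i j => (opNorm2 (M n i j - L i j) : ℂ)) < ε := by
  choose T hT using hb
  obtain ⟨S, hS, hmem, hconv⟩ := 𝒜.exists_normMatrix_limit (T := T)
    (fun n => by simpa only [(hT _ _ _).opNorm2_eq] using hM n)
    (by simpa only [((hT _ _ _).sub (hT _ _ _)).opNorm2_eq, normMatrix_sub] using hcauchy)
  have hL : ∀ i j, Represents (entries (S i j)) (S i j) := fun i j => represents_entries _
  refine ⟨fun i j => entries (S i j), fun i j k l => ?_, fun i j => ⟨_, hL i j⟩, ?_, ?_⟩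
  · simpa only [← (hT _ _ _).eq_entries] using tendsto_entries (hS i j) k l
  · simpa only [(hL _ _).opNorm2_eq] using hmem
  · simpa only [((hT _ _ _).sub (hL _ _)).opNorm2_eq, normMatrix_sub] using hconv

end SolidBanachAlgebra

/-- `(𝒜, ‖·‖_𝒜)` is complete. -/
theorem statement8 {I₁ I₂ : Type*} [Countable I₁] [Countable I₂]
    (𝒜₁ : SolidBanachAlgebra I₁) (𝒜₂ : SolidBanachAlgebra I₂)
    (f : ℕ → Tensor I₁ I₂) (hf : ∀ n, MemA 𝒜₁ 𝒜₂ (f n))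
    (hcauchy : ∀ ε > (0 : ℝ), ∃ N : ℕ, ∀ m ≥ N, ∀ n ≥ N, normA 𝒜₁ 𝒜₂ (f m - f n) < ε) :
    ∃ A : Tensor I₁ I₂, MemA 𝒜₁ 𝒜₂ A ∧
      ∀ ε > (0 : ℝ), ∃ N : ℕ, ∀ n ≥ N, normA 𝒜₁ 𝒜₂ (f n - A) < ε := by
  obtain ⟨L₁, hlim₁, hb₁, hmem₁, hconv₁⟩ := 𝒜₁.exists_opNorm2_limit (fun n => res1 (f n))
    (fun n => (hf n).1.1) (fun n => (hf n).1.2) fun ε hε => (hcauchy ε hε).imp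
      fun N hN m hm n hn => (le_max_left _ _).trans_lt (hN m hm n hn)
  obtain ⟨L₂, hlim₂, hb₂, hmem₂, hconv₂⟩ := 𝒜₂.exists_opNorm2_limit (fun n => res2 (f n))
    (fun n => (hf n).2.1) (fun n => (hf n).2.2) fun ε hε => (hcauchy ε hε).imp
      fun N hN m hm n hn => (le_max_right _ _).trans_lt (hN m hm n hn)
  have hL : L₂ = fun k l i j => L₁ i j k l := by
    funext k l i j
    exact tendsto_nhds_unique (hlim₂ k l i j) (hlim₁ i j k l)
  subst hL
  refine ⟨fun i k l j => L₁ i j k l, ⟨⟨hb₁, hmem₁⟩, hb₂, hmem₂⟩, fun ε hε => ?_⟩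
  obtain ⟨N₁, hN₁⟩ := hconv₁ ε hε
  obtain ⟨N₂, hN₂⟩ := hconv₂ ε hε
  exact ⟨max N₁ N₂, fun n hn => max_lt (hN₁ n (le_of_max_le_left hn))
    (hN₂ n (le_of_max_le_right hn))⟩

end PaperTensor
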